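/- Let Φ be a function in the class 𝓕 defined on a compact interval, and let (X, Y) be jointly distributed random variables taking values in finite sets. Then η_Φ(X, Y) = inf { (1 − λ_1)/λ_2 : (λ_1, λ_2) ∈ 𝓡_Φ(X, Y), λ_2 ≠ 0 }. -/

import Mathlib

open Finset

noncomputable section

/-- A probability mass function on a finite type. -/
def IsPMF {Ω : Type*} [Fintype Ω] (p : Ω → ℝ) : Prop :=
  (∀ ω, 0 ≤ p ω) ∧ ∑ ω, p ω = 1

/-- Expectation of `f` under the pmf `p`. -/
def expect {Ω : Type*} [Fintype Ω] (p : Ω → ℝ) (f : Ω → ℝ) : ℝ :=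
  ∑ ω, p ω * f ω

/-- Variance of `f` under the pmf `p`. -/
def var {Ω : Type*} [Fintype Ω] (p : Ω → ℝ) (f : Ω → ℝ) : ℝ :=
  ∑ ω, p ω * (f ω - expect p f) ^ 2

open scoped Classical in
/-- Conditional expectation `E[f | X]`, as a function on the sample space. -/
def condExp {Ω β : Type*} [Fintype Ω] (p : Ω → ℝ) (f : Ω → ℝ) (X : Ω → β) : Ω → ℝ :=
  fun ω => (∑ ω', if X ω' = X ω then p ω' * f ω' else 0) /
    (∑ ω', if X ω' = X ω then p ω' else 0)

/-- The Φ-entropy `H_Φ(f) = E[Φ(f)] - Φ(E[f])`. -/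
def Hphi {Ω : Type*} [Fintype Ω] (Φ : ℝ → ℝ) (p : Ω → ℝ) (f : Ω → ℝ) : ℝ :=
  expect p (fun ω => Φ (f ω)) - Φ (expect p f)

/-- The conditional Φ-entropy `H_Φ(f | X) = E[Φ(f)] - E[Φ(E[f|X])]`. -/
def HphiCond {Ω β : Type*} [Fintype Ω] (Φ : ℝ → ℝ) (p : Ω → ℝ) (f : Ω → ℝ) (X : Ω → β) : ℝ :=
  expect p (fun ω => Φ (f ω)) - expect p (fun ω => Φ (condExp p f X ω))

/-- The class 𝓕 of smooth convex non-affine functions `Φ` on a convex domain `D ⊆ ℝ`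
such that for every `q ∈ [0,1]` the map
`(s,t) ↦ q Φ(s) + (1-q) Φ(t) - Φ(q s + (1-q) t)` is jointly convex. -/
structure ClassF where
  D : Set ℝ
  Φ : ℝ → ℝ
  convex_dom : Convex ℝ D
  smooth : ContDiffOn ℝ (⊤ : ℕ∞) Φ D
  convexOn : ConvexOn ℝ D Φ
  not_affine : ¬ ∃ a b : ℝ, ∀ t ∈ D, Φ t = a * t + b
  joint_convex : ∀ q ∈ Set.Icc (0:ℝ) 1,
    ConvexOn ℝ (D ×ˢ D)
      (fun st : ℝ × ℝ => q * Φ st.1 + (1 - q) * Φ st.2 - Φ (q * st.1 + (1 - q) * st.2))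

/-- The Φ-SDPI constant `η_Φ(X, Y)` of a joint pmf `p` on `α × β`: the infimum of all `λ ≥ 0`
such that `λ H_Φ(f) ≥ H_Φ(E[f|Y])` for every function `f` of `X` with range in `D`. -/
def etaPhi {α β : Type} [Fintype α] [Fintype β]
    (Φ : ℝ → ℝ) (D : Set ℝ) (p : α × β → ℝ) : ℝ :=
  sInf {l : ℝ | 0 ≤ l ∧ ∀ f : α → ℝ, (∀ x, f x ∈ D) →
    l * Hphi Φ p (fun ω => f ω.1) ≥ Hphi Φ p (condExp p (fun ω => f ω.1) Prod.snd)}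
/-- The bipartite Φ-ribbon `𝓡_Φ(X, Y)` of a joint pmf `p` on `α × β`. -/
def ribbon2 {α β : Type} [Fintype α] [Fintype β]
    (Φ : ℝ → ℝ) (D : Set ℝ) (p : α × β → ℝ) : Set (ℝ × ℝ) :=
  {l | 0 ≤ l.1 ∧ 0 ≤ l.2 ∧ ∀ f : α × β → ℝ, (∀ ω, f ω ∈ D) →
    Hphi Φ p f ≥ l.1 * Hphi Φ p (condExp p f Prod.fst) + l.2 * Hphi Φ p (condExp p f Prod.snd)}
/-- The tangent line of a convex function lies below its graph. -/
theorem ConvexOn.tangent_le {S : Set ℝ} {f : ℝ → ℝ} (hf : ConvexOn ℝ S f)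
    (hd : DifferentiableOn ℝ f S) {x y : ℝ} (hx : x ∈ S) (hy : y ∈ S) :
    f x + derivWithin f S x * (y - x) ≤ f y := by
  rcases lt_trichotomy x y with h | rfl | h
  · have := hf.derivWithin_le_slope hx hy h (hd x hx)
    rw [slope_def_field, le_div_iff₀ (by linarith)] at this
    linarith
  · simp
  · have := hf.slope_le_derivWithin hy hx h (hd x hx)
    rw [slope_def_field, div_le_iff₀ (by linarith)] at this
    linarith

namespace ClassF

variable (F : ClassF)

theorem interior_nonempty : (interior F.D).Nonempty := by
  have h : ∃ x ∈ F.D, ∃ y ∈ F.D, x < y := by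
    by_contra! h
    apply F.not_affine
    by_cases hD : F.D.Nonempty
    · obtain ⟨x, hx⟩ := hD
      refine ⟨0, F.Φ x, fun t ht => ?_⟩
      rw [le_antisymm (h x hx t ht) (h t ht x hx)]
      ring
    · exact ⟨0, 0, fun t ht => (hD ⟨t, ht⟩).elim⟩
  obtain ⟨x, hx, y, hy, hxy⟩ := h
  have hsub : Set.Icc x y ⊆ F.D := F.convex_dom.ordConnected.out hx hy
  refine ((Set.nonempty_Ioo.2 hxy).mono ?_)
  rw [← interior_Icc]
  exact interior_mono hsub

theorem uniqueDiffOn : UniqueDiffOn ℝ F.D :=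
  uniqueDiffOn_convex F.convex_dom F.interior_nonempty

theorem differentiableOn : DifferentiableOn ℝ F.Φ F.D :=
  F.smooth.differentiableOn (by simp)

theorem contDiffOn_derivWithin : ContDiffOn ℝ 1 (derivWithin F.Φ F.D) F.D :=
  F.smooth.derivWithin F.uniqueDiffOn (by norm_cast)

/-- Increments of the derivative of `Φ` dominate its increments after contraction towards a point. -/
theorem derivWithin_contraction {c q : ℝ} (hc : c ∈ F.D) (hq : q ∈ Set.Ioc (0 : ℝ) 1)
    {x y : ℝ} (hx : x ∈ F.D) (hy : y ∈ F.D) (hxy : x ≤ y) :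
    derivWithin F.Φ F.D (q * y + (1 - q) * c) - derivWithin F.Φ F.D (q * x + (1 - q) * c)
      ≤ derivWithin F.Φ F.D y - derivWithin F.Φ F.D x := by
  have hmaps : Set.MapsTo (fun s => q * s + (1 - q) * c) F.D F.D := fun s hs =>
    F.convex_dom hs hc hq.1.le (by linarith [hq.2]) (by ring)
  set G : ℝ → ℝ := fun s => q * F.Φ s + (1 - q) * F.Φ c - F.Φ (q * s + (1 - q) * c) with hG
  have hconv : ConvexOn ℝ F.D G := by
    refine ⟨F.convex_dom, fun s hs t ht a b ha hb hab => ?_⟩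
    have h := (F.joint_convex q ⟨hq.1.le, hq.2⟩).2 (x := (s, c)) (y := (t, c))
      ⟨hs, hc⟩ ⟨ht, hc⟩ ha hb hab
    have e : a * c + b * c = c := by rw [← add_mul, hab, one_mul]
    simpa [hG, e] using h
  have hder : ∀ s ∈ F.D, HasDerivWithinAt G
      (q * derivWithin F.Φ F.D s - derivWithin F.Φ F.D (q * s + (1 - q) * c) * q) F.D s := by
    intro s hs
    have h1 := ((F.differentiableOn s hs).hasDerivWithinAt.const_mul q).add_const
      ((1 - q) * F.Φ c)
    have h2 : HasDerivWithinAt (fun s => q * s + (1 - q) * c) q F.D s := by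
      simpa using ((hasDerivWithinAt_id s F.D).const_mul q).add_const ((1 - q) * c)
    exact h1.sub ((F.differentiableOn _ (hmaps hs)).hasDerivWithinAt.comp s h2 hmaps)
  have hmono := hconv.monotoneOn_derivWithin
    (fun s hs => (hder s hs).differentiableWithinAt) hx hy hxy
  rw [(hder x hx).derivWithin (F.uniqueDiffOn x hx),
    (hder y hy).derivWithin (F.uniqueDiffOn y hy)] at hmono
  nlinarith [hq.1]

theorem exists_derivWithin_derivWithin_pos :
    ∃ c ∈ F.D, 0 < derivWithin (derivWithin F.Φ F.D) F.D c := by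
  have hd := F.contDiffOn_derivWithin.differentiableOn (by simp)
  by_contra! h
  apply F.not_affine
  obtain ⟨x, hx⟩ := F.interior_nonempty.mono interior_subset
  have hconst : ∀ y ∈ F.D, derivWithin F.Φ F.D y = derivWithin F.Φ F.D x := by
    intro y hy
    have := Convex.norm_image_sub_le_of_norm_derivWithin_le (C := 0) hd (fun z hz => by
      have h0 : 0 ≤ derivWithin (derivWithin F.Φ F.D) F.D z :=
        (F.convexOn.monotoneOn_derivWithin F.differentiableOn).derivWithin_nonneg
      simp [le_antisymm (h z hz) h0]) F.convex_dom hx hy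
    simpa [sub_eq_zero] using this
  refine ⟨derivWithin F.Φ F.D x, F.Φ x - derivWithin F.Φ F.D x * x, fun t ht => ?_⟩
  have h1 := F.convexOn.tangent_le F.differentiableOn hx ht
  have h2 := F.convexOn.tangent_le F.differentiableOn ht hx
  rw [hconst t ht] at h2
  linarith

/-- On a compact domain, the derivative of `Φ` is strongly monotone. -/
theorem exists_strongly_monotone (hcomp : IsCompact F.D) :
    ∃ m > 0, ∀ x ∈ F.D, ∀ y ∈ F.D, x ≤ y →
      m * (y - x) ≤ derivWithin F.Φ F.D y - derivWithin F.Φ F.D x := by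
  obtain ⟨c, hc, hpos⟩ := F.exists_derivWithin_derivWithin_pos
  set φ := derivWithin F.Φ F.D
  have hd : DifferentiableOn ℝ φ F.D := F.contDiffOn_derivWithin.differentiableOn (by simp)
  have hcont : ContinuousOn (derivWithin φ F.D) F.D :=
    F.contDiffOn_derivWithin.continuousOn_derivWithin F.uniqueDiffOn le_rfl
  set κ := derivWithin φ F.D c / 2
  have hev := (hcont c hc).eventually
    (lt_mem_nhds (show κ < derivWithin φ F.D c from half_lt_self hpos))
  obtain ⟨r, hr, hball⟩ := Metric.mem_nhdsWithin_iff.1 hev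
  obtain ⟨R, hR⟩ := hcomp.isBounded.subset_closedBall c
  have hR0 : 0 ≤ R := dist_nonneg.trans (hR hc)
  have hmono : MonotoneOn (fun s => φ s - κ * s) (F.D ∩ Metric.ball c r) := by
    refine monotoneOn_of_hasDerivWithinAt_nonneg (f' := fun s => derivWithin φ F.D s - κ)
      (F.convex_dom.inter (convex_ball c r)) ?_ ?_ ?_
    · exact (hd.continuousOn.mono Set.inter_subset_left).sub (by fun_prop)
    · intro s hs
      have h1 := (hd s (interior_subset hs).1).hasDerivWithinAt
      have h2 := h1.sub ((hasDerivWithinAt_id s F.D).const_mul κ)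
      simp only [mul_one] at h2
      exact h2.mono (interior_subset.trans Set.inter_subset_left)
    · intro s hs
      exact sub_nonneg.2 (Set.mem_ofPred.1 (hball (interior_subset hs).symm)).le
  set q := r / (r + R) with hq
  have hq0 : 0 < q := by positivity
  have hq1 : q ≤ 1 := by rw [hq, div_le_one (by positivity)]; linarith
  have hmem : ∀ s ∈ F.D, q * s + (1 - q) * c ∈ F.D ∩ Metric.ball c r := by
    intro s hs
    refine ⟨F.convex_dom hs hc hq0.le (by linarith) (by ring), ?_⟩
    have h1 : |s - c| ≤ R := hR hs
    rw [Metric.mem_ball, Real.dist_eq, show q * s + (1 - q) * c - c = q * (s - c) by ring,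
      abs_mul, abs_of_pos hq0]
    calc q * |s - c| ≤ q * R := by gcongr
      _ < q * (r + R) := by gcongr; linarith
      _ = r := by rw [hq]; field_simp
  refine ⟨κ * q, by positivity, fun x hx y hy hxy => ?_⟩
  have h1 := F.derivWithin_contraction hc ⟨hq0, hq1⟩ hx hy hxy
  have h2 := hmono (hmem x hx) (hmem y hy) (by gcongr)
  simp only at h2
  linarith

/-- On a compact domain, the derivative of `Φ` is Lipschitz. -/
theorem exists_lipschitz (hcomp : IsCompact F.D) :
    ∃ M > 0, ∀ x ∈ F.D, ∀ y ∈ F.D,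
      |derivWithin F.Φ F.D y - derivWithin F.Φ F.D x| ≤ M * |y - x| := by
  have hcont := F.contDiffOn_derivWithin.continuousOn_derivWithin F.uniqueDiffOn le_rfl
  obtain ⟨C, hC⟩ := hcomp.exists_bound_of_continuousOn hcont
  refine ⟨max C 1, by positivity, fun x hx y hy => ?_⟩
  exact Convex.norm_image_sub_le_of_norm_derivWithin_le
    (F.contDiffOn_derivWithin.differentiableOn (by simp))
    (fun z hz => (hC z hz).trans (le_max_left _ _)) F.convex_dom hx hy

/-- On a compact domain, the Bregman divergence of `Φ` is comparable to the squared distance. -/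
theorem exists_quadratic_bounds (hcomp : IsCompact F.D) :
    ∃ (φ : ℝ → ℝ) (m M : ℝ), 0 < m ∧ 0 < M ∧
      (∀ x ∈ F.D, ∀ y ∈ F.D, F.Φ x + φ x * (y - x) + m * (y - x) ^ 2 ≤ F.Φ y) ∧
      (∀ x ∈ F.D, ∀ y ∈ F.D, F.Φ y ≤ F.Φ x + φ x * (y - x) + M * (y - x) ^ 2) ∧
      (∀ x ∈ F.D, ∀ y ∈ F.D, |φ y - φ x| ≤ M * |y - x|) := by
  obtain ⟨m, hm, hmono⟩ := F.exists_strongly_monotone hcomp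
  obtain ⟨M, hM, hlip⟩ := F.exists_lipschitz hcomp
  have htan := fun {x y : ℝ} => F.convexOn.tangent_le F.differentiableOn (x := x) (y := y)
  set φ := derivWithin F.Φ F.D
  refine ⟨φ, m / 4, M, by positivity, hM, fun x hx y hy => ?_, fun x hx y hy => ?_, hlip⟩
  · have hz : 2⁻¹ * x + 2⁻¹ * y ∈ F.D :=
      F.convex_dom hx hy (by norm_num) (by norm_num) (by norm_num)
    set z := 2⁻¹ * x + 2⁻¹ * y with hzdef
    have h1 := htan hx hz
    have h2 := htan hz hy
    have h3 : m * ((z - x) * (y - x)) ≤ (φ z - φ x) * (y - x) := by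
      rcases le_total x y with h | h
      · have := hmono x hx z hz (by linarith)
        nlinarith
      · have := hmono z hz x hx (by linarith)
        nlinarith
    have e1 : z - x = (y - x) / 2 := by rw [hzdef]; ring
    have e2 : y - z = (y - x) / 2 := by rw [hzdef]; ring
    rw [e1] at h1 h3
    rw [e2] at h2
    nlinarith
  · have h1 := htan hy hx
    have h2 : (φ y - φ x) * (y - x) ≤ M * (y - x) ^ 2 := by
      calc (φ y - φ x) * (y - x) ≤ |φ y - φ x| * |y - x| := by
            rw [← abs_mul]; exact le_abs_self _
        _ ≤ M * |y - x| * |y - x| := by gcongr; exact hlip x hx y hy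
        _ = M * (y - x) ^ 2 := by rw [mul_assoc, ← sq, sq_abs]
    linarith

end ClassF

section Expectation

variable {Ω : Type*} [Fintype Ω] {p : Ω → ℝ}

theorem pmfExpect_add (f g : Ω → ℝ) :
    expect p (fun ω => f ω + g ω) = expect p f + expect p g := by
  simp [_root_.expect, mul_add, sum_add_distrib]

theorem pmfExpect_sub (f g : Ω → ℝ) :
    expect p (fun ω => f ω - g ω) = expect p f - expect p g := by
  simp [_root_.expect, mul_sub, sum_sub_distrib]

theorem pmfExpect_const_mul (a : ℝ) (f : Ω → ℝ) :
    expect p (fun ω => a * f ω) = a * expect p f := by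
  simp only [_root_.expect, mul_sum]
  exact sum_congr rfl fun ω _ => by ring

theorem IsPMF.expect_const (hp : IsPMF p) (a : ℝ) : expect p (fun _ => a) = a := by
  rw [_root_.expect, ← sum_mul, hp.2, one_mul]

theorem pmfExpect_congr {f g : Ω → ℝ} (h : ∀ ω, p ω ≠ 0 → f ω = g ω) :
    expect p f = expect p g := by
  refine sum_congr rfl fun ω _ => ?_
  by_cases h0 : p ω = 0
  · simp [h0]
  · rw [h ω h0]

theorem IsPMF.expect_mono (hp : IsPMF p) {f g : Ω → ℝ} (h : ∀ ω, p ω ≠ 0 → f ω ≤ g ω) :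
    expect p f ≤ expect p g := by
  refine sum_le_sum fun ω _ => ?_
  by_cases h0 : p ω = 0
  · simp [h0]
  · exact mul_le_mul_of_nonneg_left (h ω h0) (hp.1 ω)

theorem IsPMF.expect_mem (hp : IsPMF p) {D : Set ℝ} (hD : Convex ℝ D) {f : Ω → ℝ}
    (hf : ∀ ω, p ω ≠ 0 → f ω ∈ D) : expect p f ∈ D := by
  obtain ⟨ω₀, h₀⟩ : ∃ ω, p ω ≠ 0 := by
    by_contra! h
    simpa [h] using hp.2
  classical
  have := hD.sum_mem (t := univ) (w := p) (z := fun ω => if p ω = 0 then f ω₀ else f ω)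
    (fun ω _ => hp.1 ω) hp.2 (fun ω _ => by
      by_cases h : p ω = 0
      · simpa [h] using hf ω₀ h₀
      · simpa [h] using hf ω h)
  convert this using 1
  refine sum_congr rfl fun ω _ => ?_
  by_cases h : p ω = 0 <;> simp [h]

theorem Hphi_congr {Φ : ℝ → ℝ} {f g : Ω → ℝ} (h : ∀ ω, p ω ≠ 0 → f ω = g ω) :
    Hphi Φ p f = Hphi Φ p g := by
  rw [Hphi, Hphi, pmfExpect_congr h, pmfExpect_congr fun ω hω => by rw [h ω hω]]

end Expectation

section CondExp

variable {Ω γ : Type*} [Fintype Ω] {p : Ω → ℝ} {X : Ω → γ}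

theorem condExp_congr {f g : Ω → ℝ} (h : ∀ ω, p ω ≠ 0 → f ω = g ω) :
    condExp p f X = condExp p g X := by
  classical
  funext ω
  unfold condExp
  congr 1
  refine sum_congr rfl fun ω' _ => ?_
  by_cases h0 : p ω' = 0
  · simp [h0]
  · rw [h ω' h0]

theorem condExp_sub (f g : Ω → ℝ) (ω : Ω) :
    condExp p (fun ω => f ω - g ω) X ω = condExp p f X ω - condExp p g X ω := by
  classical
  unfold condExp
  rw [← sub_div, ← sum_sub_distrib]
  congr 1
  refine sum_congr rfl fun ω' _ => ?_
  split_ifs <;> ring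

theorem condExp_eq_of_eq (f : Ω → ℝ) {ω ω' : Ω} (h : X ω = X ω') :
    condExp p f X ω = condExp p f X ω' := by
  unfold condExp
  rw [h]

open scoped Classical in
theorem IsPMF.fiber_pos (hp : IsPMF p) {ω : Ω} (h : p ω ≠ 0) :
    0 < ∑ ω', if X ω' = X ω then p ω' else 0 := by
  refine sum_pos' (fun ω' _ => ?_) ⟨ω, mem_univ _, ?_⟩
  · split_ifs
    exacts [hp.1 ω', le_rfl]
  · simpa using lt_of_le_of_ne (hp.1 ω) h.symm

theorem IsPMF.condExp_mem (hp : IsPMF p) {D : Set ℝ} (hD : Convex ℝ D) {f : Ω → ℝ}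
    (hf : ∀ ω, f ω ∈ D) {ω : Ω} (h : p ω ≠ 0) : condExp p f X ω ∈ D := by
  classical
  have hW := hp.fiber_pos (X := X) h
  have := hD.sum_mem (t := univ) (z := f)
    (w := fun ω' => (if X ω' = X ω then p ω' else 0) / ∑ ω', if X ω' = X ω then p ω' else 0)
    (fun ω' _ => div_nonneg (by split_ifs; exacts [hp.1 ω', le_rfl]) hW.le)
    (by rw [← sum_div, div_self hW.ne']) (fun ω' _ => hf ω')
  convert this using 1
  rw [condExp, sum_div]
  refine sum_congr rfl fun ω' _ => ?_
  split_ifs <;> simp [div_mul_eq_mul_div]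

theorem IsPMF.condExp_of_factor (hp : IsPMF p) {f : Ω → ℝ}
    (hf : ∀ ω ω', X ω = X ω' → f ω = f ω') {ω : Ω} (h : p ω ≠ 0) :
    condExp p f X ω = f ω := by
  classical
  have hW := hp.fiber_pos (X := X) h
  rw [condExp, div_eq_iff hW.ne', mul_sum]
  refine sum_congr rfl fun ω' _ => ?_
  split_ifs with hX
  · rw [hf _ _ hX, mul_comm]
  · simp

theorem IsPMF.expect_mul_condExp (hp : IsPMF p) (f : Ω → ℝ) {h : Ω → ℝ}
    (hh : ∀ ω ω', X ω = X ω' → h ω = h ω') :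
    expect p (fun ω => h ω * condExp p f X ω) = expect p (fun ω => h ω * f ω) := by
  classical
  set W : Ω → ℝ := fun ω => ∑ ω', if X ω' = X ω then p ω' else 0 with hWdef
  have hW : ∀ ω ω', X ω = X ω' → W ω = W ω' := fun ω ω' e => by simp only [hWdef, e]
  calc expect p (fun ω => h ω * condExp p f X ω)
      = ∑ ω, ∑ ω', if X ω' = X ω then p ω * (h ω * (p ω' * f ω' / W ω)) else 0 := by
        refine sum_congr rfl fun ω _ => ?_
        simp only [condExp, sum_div, mul_sum]
        refine sum_congr rfl fun ω' _ => ?_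
        split_ifs <;> simp [hWdef]
    _ = ∑ ω', ∑ ω, if X ω = X ω' then p ω * (h ω' * (p ω' * f ω' / W ω')) else 0 := by
        rw [sum_comm]
        refine sum_congr rfl fun ω' _ => sum_congr rfl fun ω _ => ?_
        by_cases e : X ω' = X ω
        · rw [if_pos e, if_pos e.symm, hh _ _ e, hW _ _ e]
        · rw [if_neg e, if_neg (Ne.symm e)]
    _ = expect p (fun ω => h ω * f ω) := by
        refine sum_congr rfl fun ω' _ => ?_
        have e : (∑ ω, if X ω = X ω' then p ω * (h ω' * (p ω' * f ω' / W ω')) else 0)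
            = W ω' * (h ω' * (p ω' * f ω' / W ω')) := by
          rw [hWdef, sum_mul]
          refine sum_congr rfl fun ω _ => ?_
          split_ifs <;> simp
        rw [e]
        by_cases h0 : p ω' = 0
        · simp [h0]
        · have := (hp.fiber_pos (X := X) h0).ne'
          change W ω' ≠ 0 at this
          field_simp

theorem IsPMF.expect_condExp (hp : IsPMF p) (f : Ω → ℝ) :
    expect p (condExp p f X) = expect p f := by
  simpa using hp.expect_mul_condExp f (X := X) (h := fun _ => 1) fun _ _ _ => rfl

theorem IsPMF.expect_condExp_sq_le (hp : IsPMF p) (f : Ω → ℝ) :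
    expect p (fun ω => condExp p f X ω ^ 2) ≤ expect p (fun ω => f ω ^ 2) := by
  have horth := hp.expect_mul_condExp (X := X) f (h := condExp p f X)
    fun _ _ e => condExp_eq_of_eq f e
  have hmono := hp.expect_mono (f := fun ω => 2 * (condExp p f X ω * f ω))
    (g := fun ω => condExp p f X ω ^ 2 + f ω ^ 2)
    fun ω _ => by nlinarith [sq_nonneg (condExp p f X ω - f ω)]
  rw [pmfExpect_const_mul, pmfExpect_add, ← horth] at hmono
  simp only [← sq] at hmono
  linarith

end CondExp

section QuadraticBounds

variable {Ω γ : Type*} [Fintype Ω] {p : Ω → ℝ} {X : Ω → γ} {D : Set ℝ} {Φ φ : ℝ → ℝ} {m M : ℝ}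

theorem IsPMF.sq_le_Hphi (hp : IsPMF p) (hD : Convex ℝ D)
    (hlow : ∀ x ∈ D, ∀ y ∈ D, Φ x + φ x * (y - x) + m * (y - x) ^ 2 ≤ Φ y)
    {f : Ω → ℝ} (hf : ∀ ω, p ω ≠ 0 → f ω ∈ D) :
    m * expect p (fun ω => (f ω - expect p f) ^ 2) ≤ Hphi Φ p f := by
  have h := hp.expect_mono fun ω hω => hlow _ (hp.expect_mem hD hf) _ (hf ω hω)
  rw [pmfExpect_add, pmfExpect_add, hp.expect_const, pmfExpect_const_mul, pmfExpect_const_mul, pmfExpect_sub,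
    hp.expect_const, sub_self] at h
  unfold Hphi
  linarith

theorem IsPMF.sq_le_Hphi_sub (hp : IsPMF p) (hD : Convex ℝ D)
    (hlow : ∀ x ∈ D, ∀ y ∈ D, Φ x + φ x * (y - x) + m * (y - x) ^ 2 ≤ Φ y)
    {f : Ω → ℝ} (hf : ∀ ω, f ω ∈ D) :
    m * expect p (fun ω => (f ω - condExp p f X ω) ^ 2)
      ≤ Hphi Φ p f - Hphi Φ p (condExp p f X) := by
  have h := hp.expect_mono fun ω hω => hlow _ (hp.condExp_mem (X := X) hD hf hω) _ (hf ω)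
  have horth := hp.expect_mul_condExp (X := X) f (h := fun ω => φ (condExp p f X ω))
    fun _ _ e => by rw [condExp_eq_of_eq f e]
  simp only [mul_sub] at h
  rw [pmfExpect_add, pmfExpect_add, pmfExpect_const_mul, pmfExpect_sub, horth, sub_self] at h
  unfold Hphi
  rw [hp.expect_condExp]
  linarith

/-- If `u` and `v` have the same mean, `H_Φ(u) - H_Φ(v)` is controlled by an arbitrarily small
multiple of the variance of `v` and a multiple of the mean square of `u - v`. -/
theorem IsPMF.Hphi_le_of_expect_eq (hp : IsPMF p) (hD : Convex ℝ D)
    (hup : ∀ x ∈ D, ∀ y ∈ D, Φ y ≤ Φ x + φ x * (y - x) + M * (y - x) ^ 2)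
    (hlip : ∀ x ∈ D, ∀ y ∈ D, |φ y - φ x| ≤ M * |y - x|)
    {u v : Ω → ℝ} (hu : ∀ ω, p ω ≠ 0 → u ω ∈ D) (hv : ∀ ω, p ω ≠ 0 → v ω ∈ D)
    (huv : expect p u = expect p v) {t : ℝ} (ht : 0 < t) :
    Hphi Φ p u ≤ Hphi Φ p v + t * expect p (fun ω => (v ω - expect p v) ^ 2)
      + (M ^ 2 / (4 * t) + M) * expect p (fun ω => (u ω - v ω) ^ 2) := by
  set μ := expect p v
  have h := hp.expect_mono (f := fun ω => Φ (u ω)) (g := fun ω => Φ (v ω) + φ μ * (u ω - v ω)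
      + t * (v ω - μ) ^ 2 + (M ^ 2 / (4 * t) + M) * (u ω - v ω) ^ 2) fun ω hω => by
    have h1 := hup _ (hv ω hω) _ (hu ω hω)
    have h2 := hlip _ (hp.expect_mem hD hv) _ (hv ω hω)
    have h3 : (φ (v ω) - φ μ) * (u ω - v ω) ≤ M * |v ω - μ| * |u ω - v ω| := by
      refine (le_abs_self _).trans ?_
      rw [abs_mul]
      gcongr
    have h4 : M * |v ω - μ| * |u ω - v ω|
        ≤ t * (v ω - μ) ^ 2 + M ^ 2 / (4 * t) * (u ω - v ω) ^ 2 := by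
      rw [← sq_abs (v ω - μ), ← sq_abs (u ω - v ω)]
      have e : t * |v ω - μ| ^ 2 + M ^ 2 / (4 * t) * |u ω - v ω| ^ 2
          - M * |v ω - μ| * |u ω - v ω|
          = (2 * t * |v ω - μ| - M * |u ω - v ω|) ^ 2 / (4 * t) := by
        field_simp
        ring
      have : 0 ≤ (2 * t * |v ω - μ| - M * |u ω - v ω|) ^ 2 / (4 * t) := by positivity
      linarith
    linarith
  rw [pmfExpect_add, pmfExpect_add, pmfExpect_add, pmfExpect_const_mul, pmfExpect_const_mul, pmfExpect_const_mul,
    pmfExpect_sub, huv, sub_self] at h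
  unfold Hphi
  rw [huv]
  linarith

end QuadraticBounds

section Ribbon

variable {α β : Type} [Fintype α] [Fintype β] {p : α × β → ℝ}

theorem IsPMF.condExp_fst_eq (hp : IsPMF p) {D : Set ℝ} (hD : Convex ℝ D) {f : α × β → ℝ}
    (hf : ∀ ω, f ω ∈ D) :
    ∃ g : α → ℝ, (∀ x, g x ∈ D) ∧ ∀ ω, p ω ≠ 0 → condExp p f Prod.fst ω = g ω.1 := by
  have key : ∀ x : α, ∃ y ∈ D, ∀ b, p (x, b) ≠ 0 → condExp p f Prod.fst (x, b) = y := by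
    intro x
    by_cases h : ∃ b, p (x, b) ≠ 0
    · obtain ⟨b, hb⟩ := h
      exact ⟨_, hp.condExp_mem hD hf hb, fun b' _ => condExp_eq_of_eq f rfl⟩
    · push Not at h
      exact ⟨_, hp.expect_mem hD fun ω _ => hf ω, fun b hb => (hb (h b)).elim⟩
  choose g hg hgc using key
  exact ⟨g, hg, fun ω hω => hgc ω.1 ω.2 hω⟩

/-- Every element of the set defining `η_Φ`, increased by an arbitrary `δ > 0`, is of the form
`(1 - λ₁) / λ₂` with `(λ₁, λ₂)` in the ribbon. -/
theorem ClassF.exists_mem_ribbon2 (F : ClassF) (hcomp : IsCompact F.D) (hp : IsPMF p)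
    {l δ : ℝ} (hl : 0 ≤ l) (hδ : 0 < δ)
    (hsdpi : ∀ f : α → ℝ, (∀ x, f x ∈ F.D) → l * Hphi F.Φ p (fun ω => f ω.1)
      ≥ Hphi F.Φ p (condExp p (fun ω => f ω.1) Prod.snd)) :
    ∃ ε > 0, (1 - ε * (l + δ), ε) ∈ ribbon2 F.Φ F.D p := by
  obtain ⟨φ, m, M, hm, hM, hlow, hup, hlip⟩ := F.exists_quadratic_bounds hcomp
  have hD := F.convex_dom
  set K := M ^ 2 / (4 * (δ * m)) + M
  have hK0 : 0 < K := by positivity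
  set ε := min (m / K) (1 / (l + δ))
  have hε0 : 0 < ε := lt_min (by positivity) (by positivity)
  have hε1 : ε * (l + δ) ≤ 1 := (le_div_iff₀ (by positivity)).1 (min_le_right _ _)
  have hε2 : ε * K ≤ m := (le_div_iff₀ hK0).1 (min_le_left _ _)
  refine ⟨ε, hε0, by simpa using hε1, hε0.le, fun f hf => ?_⟩
  obtain ⟨g, hg, hfg⟩ := hp.condExp_fst_eq hD hf
  set c := condExp p f Prod.fst with hc
  set u := condExp p f Prod.snd with hu
  set v := condExp p c Prod.snd with hv
  have hcD : ∀ ω, p ω ≠ 0 → c ω ∈ F.D := fun ω hω => hfg ω hω ▸ hg ω.1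
  have hvg : v = condExp p (fun ω => g ω.1) Prod.snd := condExp_congr hfg
  have hsd : Hphi F.Φ p v ≤ l * Hphi F.Φ p c := by
    rw [Hphi_congr hfg, hvg]
    exact hsdpi g hg
  have hvD : ∀ ω, p ω ≠ 0 → v ω ∈ F.D := fun ω hω => by
    rw [hvg]
    exact hp.condExp_mem hD (fun ω => hg ω.1) hω
  have hmean : expect p u = expect p v := by
    rw [hu, hv, hc, hp.expect_condExp, hp.expect_condExp, hp.expect_condExp]
  have hpert := hp.Hphi_le_of_expect_eq hD hup hlip
    (fun ω hω => hp.condExp_mem hD hf hω) hvD hmean (mul_pos hδ hm)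
  have hvar : expect p (fun ω => (v ω - expect p v) ^ 2)
      ≤ expect p (fun ω => (c ω - expect p c) ^ 2) := by
    have h1 := hp.expect_condExp_sq_le (X := Prod.snd) (fun ω => c ω - expect p c)
    rwa [pmfExpect_congr (g := fun ω => (v ω - expect p v) ^ 2) fun ω hω => by
      rw [condExp_sub, hp.condExp_of_factor (f := fun _ => expect p c) (fun _ _ _ => rfl) hω,
        hv, hp.expect_condExp (X := Prod.snd) c]] at h1
  have hvarc := hp.sq_le_Hphi hD hlow hcD
  have hdiff : expect p (fun ω => (u ω - v ω) ^ 2) ≤ expect p (fun ω => (f ω - c ω) ^ 2) := by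
    have h1 := hp.expect_condExp_sq_le (X := Prod.snd) (fun ω => f ω - c ω)
    simpa only [condExp_sub] using h1
  have hent := hp.sq_le_Hphi_sub (X := Prod.fst) hD hlow hf
  have hdiff0 : 0 ≤ expect p (fun ω => (f ω - c ω) ^ 2) :=
    sum_nonneg fun ω _ => mul_nonneg (hp.1 ω) (sq_nonneg _)
  have hHu : Hphi F.Φ p u ≤ (l + δ) * Hphi F.Φ p c
      + K * expect p (fun ω => (f ω - c ω) ^ 2) := by
    have h1 := mul_le_mul_of_nonneg_left hdiff hK0.le
    have h2 := mul_le_mul_of_nonneg_left (hvar.trans ((le_div_iff₀' hm).2 hvarc))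
      (mul_pos hδ hm).le
    rw [mul_assoc δ m (_ / _), mul_div_cancel₀ _ hm.ne'] at h2
    linarith
  have h3 := mul_le_mul_of_nonneg_left hHu hε0.le
  have h4 := mul_le_mul_of_nonneg_right hε2 hdiff0
  change Hphi F.Φ p f ≥ (1 - ε * (l + δ)) * Hphi F.Φ p c + ε * Hphi F.Φ p u
  linarith

theorem ClassF.Hphi_condExp_le (F : ClassF) (hcomp : IsCompact F.D) {Ω γ : Type*} [Fintype Ω]
    {p : Ω → ℝ} (hp : IsPMF p) {X : Ω → γ} {f : Ω → ℝ} (hf : ∀ ω, f ω ∈ F.D) :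
    Hphi F.Φ p (condExp p f X) ≤ Hphi F.Φ p f := by
  obtain ⟨φ, m, M, hm, hM, hlow, -, -⟩ := F.exists_quadratic_bounds hcomp
  have h := hp.sq_le_Hphi_sub (X := X) F.convex_dom hlow hf
  have h0 : 0 ≤ expect p (fun ω => (f ω - condExp p f X ω) ^ 2) :=
    sum_nonneg fun ω _ => mul_nonneg (hp.1 ω) (sq_nonneg _)
  linarith [mul_nonneg hm.le h0]

theorem ClassF.Hphi_nonneg (F : ClassF) (hcomp : IsCompact F.D) {Ω : Type*} [Fintype Ω]
    {p : Ω → ℝ} (hp : IsPMF p) {f : Ω → ℝ} (hf : ∀ ω, p ω ≠ 0 → f ω ∈ F.D) :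
    0 ≤ Hphi F.Φ p f := by
  obtain ⟨φ, m, M, hm, hM, hlow, -, -⟩ := F.exists_quadratic_bounds hcomp
  have h := hp.sq_le_Hphi F.convex_dom hlow hf
  have h0 : 0 ≤ expect p (fun ω => (f ω - expect p f) ^ 2) :=
    sum_nonneg fun ω _ => mul_nonneg (hp.1 ω) (sq_nonneg _)
  linarith [mul_nonneg hm.le h0]

/-- For `(λ₁, λ₂)` in the ribbon, functions of the first coordinate satisfy the corresponding
strong data processing inequality. -/
theorem IsPMF.mul_Hphi_condExp_snd_le (hp : IsPMF p) {Φ : ℝ → ℝ} {D : Set ℝ} {a : ℝ × ℝ}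
    (ha : a ∈ ribbon2 Φ D p) {f : α → ℝ} (hf : ∀ x, f x ∈ D) :
    a.2 * Hphi Φ p (condExp p (fun ω => f ω.1) Prod.snd)
      ≤ (1 - a.1) * Hphi Φ p (fun ω => f ω.1) := by
  have h := ha.2.2 (fun ω => f ω.1) fun ω => hf ω.1
  rw [Hphi_congr (f := condExp p (fun ω => f ω.1) Prod.fst) fun ω hω =>
    hp.condExp_of_factor (fun _ _ e => by rw [e]) hω] at h
  linarith

end Ribbon

/-- For `Φ ∈ 𝓕` defined on a compact interval,
`η_Φ(X, Y) = inf { (1 − λ₁)/λ₂ : (λ₁, λ₂) ∈ 𝓡_Φ(X, Y), λ₂ ≠ 0 }`. -/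
theorem etaPhi_eq_inf_ribbon
    {α β : Type} [Fintype α] [Fintype β]
    (p : α × β → ℝ) (hp : IsPMF p)
    (F : ClassF) (hcomp : IsCompact F.D) :
    etaPhi F.Φ F.D p
      = sInf ((fun l : ℝ × ℝ => (1 - l.1) / l.2) ''
          {l ∈ ribbon2 F.Φ F.D p | l.2 ≠ 0}) := by
  by_cases hdeg : ∀ f : α → ℝ, (∀ x, f x ∈ F.D) → Hphi F.Φ p (fun ω => f ω.1) ≤ 0
  · have hzero : ∀ f : α → ℝ, (∀ x, f x ∈ F.D) → Hphi F.Φ p (fun ω => f ω.1) = 0 :=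
      fun f hf => (hdeg f hf).antisymm (F.Hphi_nonneg hcomp hp fun ω _ => hf ω.1)
    have hleft : etaPhi F.Φ F.D p = 0 := by
      refine IsLeast.csInf_eq ⟨⟨le_rfl, fun f hf => ?_⟩, fun l hl => hl.1⟩
      rw [zero_mul]
      exact (F.Hphi_condExp_le hcomp hp fun ω => hf ω.1).trans (hdeg f hf)
    rw [hleft, Real.sInf_of_not_bddBelow]
    rintro ⟨b, hb⟩
    -- here `λ₁` is unconstrained, so the set on the right has no lower bound
    have hmem : (2 + |b|, (1 : ℝ)) ∈ ribbon2 F.Φ F.D p := by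
      refine ⟨by positivity, zero_le_one, fun f hf => ?_⟩
      obtain ⟨g, hg, hfg⟩ := hp.condExp_fst_eq F.convex_dom hf
      rw [Hphi_congr hfg, hzero g hg]
      simpa using F.Hphi_condExp_le hcomp hp hf
    have := hb ⟨_, ⟨hmem, one_ne_zero⟩, rfl⟩
    simp only [div_one] at this
    linarith [neg_abs_le b]
  · push Not at hdeg
    obtain ⟨f₀, hf₀, hpos⟩ := hdeg
    set S := {l : ℝ | 0 ≤ l ∧ ∀ f : α → ℝ, (∀ x, f x ∈ F.D) →
      l * Hphi F.Φ p (fun ω => f ω.1) ≥ Hphi F.Φ p (condExp p (fun ω => f ω.1) Prod.snd)}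
    set T := (fun l : ℝ × ℝ => (1 - l.1) / l.2) '' {l ∈ ribbon2 F.Φ F.D p | l.2 ≠ 0}
    change sInf S = sInf T
    have hSne : S.Nonempty := ⟨1, zero_le_one, fun f hf => by
      rw [one_mul]
      exact F.Hphi_condExp_le hcomp hp fun ω => hf ω.1⟩
    have hSbdd : BddBelow S := ⟨0, fun l hl => hl.1⟩
    have hTS : T ⊆ S := by
      rintro _ ⟨a, ⟨ha, ha2⟩, rfl⟩
      have ha2 : 0 < a.2 := lt_of_le_of_ne ha.2.1 (Ne.symm ha2)
      have hsdpi : ∀ f : α → ℝ, (∀ x, f x ∈ F.D) →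
          Hphi F.Φ p (condExp p (fun ω => f ω.1) Prod.snd)
            ≤ (1 - a.1) / a.2 * Hphi F.Φ p (fun ω => f ω.1) := fun f hf => by
        rw [div_mul_eq_mul_div, le_div_iff₀' ha2]
        exact hp.mul_Hphi_condExp_snd_le ha hf
      refine ⟨?_, hsdpi⟩
      have h1 := F.Hphi_nonneg hcomp hp fun ω hω =>
        hp.condExp_mem (X := Prod.snd) F.convex_dom (fun ω => hf₀ ω.1) hω
      exact nonneg_of_mul_nonneg_left (h1.trans (hsdpi f₀ hf₀)) hpos
    have hST : ∀ l ∈ S, ∀ δ > 0, l + δ ∈ T := fun l hl δ hδ => by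
      obtain ⟨ε, hε, hmem⟩ := F.exists_mem_ribbon2 hcomp hp hl.1 hδ hl.2
      refine ⟨_, ⟨hmem, hε.ne'⟩, ?_⟩
      simp only [sub_sub_cancel]
      field_simp
    obtain ⟨l₀, hl₀⟩ := hSne
    refine le_antisymm (csInf_le_csInf hSbdd ⟨_, hST l₀ hl₀ 1 one_pos⟩ hTS) ?_
    refine le_csInf ⟨l₀, hl₀⟩ fun l hl => le_of_forall_pos_le_add fun δ hδ => ?_
    exact csInf_le (hSbdd.mono hTS) (hST l hl δ hδ)

end
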